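/- Let t₀ ≥ 1 and d be real numbers with 0 < d < 1. Then there exists a unique ρ ∈ (0, 1) such that t₀^{ρ−1} / Γ(ρ) = d. -/

import Mathlib

theorem Real.continuousOn_rpow_sub_one_div_Gamma {t : ℝ} (ht : 0 < t) :
    ContinuousOn (fun x : ℝ => t ^ (x - 1) / Real.Gamma x) (Set.Icc 0 1) := by
  have h : ContinuousOn (fun x : ℝ => t ^ (x - 1) * x / Real.Gamma (x + 1)) (Set.Icc 0 1) := by
    intro x hx
    have hx1 : 0 < x + 1 := by linarith [hx.1]
    have hΓ : ContinuousAt Real.Gamma (x + 1) :=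
      (Real.differentiableOn_Gamma_Ioi.continuousOn).continuousAt (Ioi_mem_nhds hx1)
    have hpow : ContinuousAt (fun y : ℝ => t ^ (y - 1)) x :=
      continuousAt_const.rpow (continuousAt_id.sub continuousAt_const) (Or.inl ht.ne')
    exact ((hpow.mul continuousAt_id).div
      (ContinuousAt.comp' hΓ (continuousAt_id.add continuousAt_const))
      (Real.Gamma_pos_of_pos hx1).ne').continuousWithinAt
  refine h.congr fun x hx => ?_
  rcases hx.1.eq_or_lt with rfl | hx0
  · simp
  · have := Real.Gamma_pos_of_pos hx0
    simp only [Real.Gamma_add_one hx0.ne']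
    field_simp

theorem Real.strictMonoOn_rpow_sub_one_div_Gamma {t : ℝ} (ht : 1 ≤ t) :
    StrictMonoOn (fun x : ℝ => t ^ (x - 1) / Real.Gamma x) (Set.Ioc 0 1) := by
  intro x hx y hy hxy
  exact div_lt_div₀' (Real.rpow_le_rpow_of_exponent_le ht (by linarith))
    (Real.Gamma_strictAntiOn_Ioc hx hy hxy) (Real.rpow_pos_of_pos (by linarith) _)
    (Real.Gamma_pos_of_pos hy.1)

/-- Let `t₀ ≥ 1` and `0 < d < 1`. Then there exists a unique `ρ ∈ (0, 1)`
such that `t₀^{ρ−1} / Γ(ρ) = d`. -/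
theorem existsUnique_order (t₀ d : ℝ) (ht₀ : 1 ≤ t₀) (hd0 : 0 < d) (hd1 : d < 1) :
    ∃! ρ : ℝ, ρ ∈ Set.Ioo (0 : ℝ) 1 ∧ t₀ ^ (ρ - 1) / Real.Gamma ρ = d := by
  obtain ⟨ρ, hρ, hρd⟩ := intermediate_value_Ioo zero_le_one
    (Real.continuousOn_rpow_sub_one_div_Gamma (by linarith : 0 < t₀))
    (by simpa using ⟨hd0, hd1⟩ : d ∈ _)
  refine ⟨ρ, ⟨hρ, hρd⟩, fun σ hσ => ?_⟩
  exact (Real.strictMonoOn_rpow_sub_one_div_Gamma ht₀).injOn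
    (Set.Ioo_subset_Ioc_self hσ.1) (Set.Ioo_subset_Ioc_self hρ) (hσ.2.trans hρd.symm)
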